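/- Let r_n be an extreme space scale and let β > β_c, α = β_c/β. Then for each fixed u > 0 and any sequence u_n with u_n → u, one has g_n(u_n) → u^{-1/α} as n → ∞. -/

import Mathlib

open Filter MeasureTheory

/-- The standard Gaussian density `φ(x) = (2π)^{-1/2} e^{-x²/2}`. -/
noncomputable def phi (x : ℝ) : ℝ := (Real.sqrt (2 * Real.pi))⁻¹ * Real.exp (-x ^ 2 / 2)

/-- The standard Gaussian distribution function `Φ(x) = ∫_{-∞}^x φ(y) dy`. -/
noncomputable def Phi (x : ℝ) : ℝ := ∫ y in Set.Iic x, phi y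

/-- `G_n^{-1}(u) = inf {v ≥ 0 : G_n(v) ≤ u}` where `G_n(v) = 1 - Φ(log v/(β√n))`. -/
noncomputable def Ginv (β : ℝ) (n : ℕ) (u : ℝ) : ℝ :=
  sInf {v : ℝ | 0 ≤ v ∧ 1 - Phi (Real.log v / (β * Real.sqrt n)) ≤ u}

theorem phi_pos (x : ℝ) : 0 < phi x := by
  unfold phi
  positivity

theorem phi_eq_gaussianPDFReal : phi = ProbabilityTheory.gaussianPDFReal 0 1 := by
  ext x
  simp [phi, ProbabilityTheory.gaussianPDFReal]

theorem integrable_phi : Integrable phi := by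
  rw [phi_eq_gaussianPDFReal]
  exact ProbabilityTheory.integrable_gaussianPDFReal 0 1

theorem integral_phi : ∫ x, phi x = 1 := by
  rw [phi_eq_gaussianPDFReal]
  exact ProbabilityTheory.integral_gaussianPDFReal_eq_one 0 one_ne_zero

theorem hasDerivAt_phi (x : ℝ) : HasDerivAt phi (-x * phi x) x := by
  have h := (((hasDerivAt_pow 2 x).neg.div_const 2).exp).const_mul (Real.sqrt (2 * Real.pi))⁻¹
  have hval : -x * phi x = (Real.sqrt (2 * Real.pi))⁻¹ *
      (Real.exp (-x ^ 2 / 2) * (-(2 * x ^ (2 - 1)) / 2)) := by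
    rw [phi]
    ring
  rw [hval]
  exact_mod_cast h

theorem continuous_phi : Continuous phi :=
  continuous_iff_continuousAt.2 fun x => (hasDerivAt_phi x).continuousAt

theorem hasDerivAt_Phi (x : ℝ) : HasDerivAt Phi (phi x) x := by
  have h : Phi = fun x => Phi 0 + ∫ y in (0 : ℝ)..x, phi y := by
    ext z
    rw [← intervalIntegral.integral_Iic_sub_Iic integrable_phi.integrableOn
      integrable_phi.integrableOn]
    simp [Phi]
  rw [h]
  exact (intervalIntegral.integral_hasDerivAt_right integrable_phi.intervalIntegrable
    (continuous_phi.stronglyMeasurableAtFilter _ _) continuous_phi.continuousAt).const_add _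

theorem tendsto_Phi_atTop : Tendsto Phi atTop (nhds 1) := by
  rw [← integral_phi]
  exact (aecover_Iic tendsto_id).integral_tendsto_of_countably_generated integrable_phi

theorem strictAnti_one_sub_Phi : StrictAnti fun x => 1 - Phi x :=
  strictAnti_of_hasDerivAt_neg (fun x => (hasDerivAt_Phi x).const_sub 1)
    fun x => neg_neg_of_pos (phi_pos x)

theorem tendsto_one_sub_Phi_atTop : Tendsto (fun x => 1 - Phi x) atTop (nhds 0) := by
  simpa using tendsto_Phi_atTop.const_sub 1

theorem one_sub_Phi_pos (x : ℝ) : 0 < 1 - Phi x :=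
  (strictAnti_one_sub_Phi.antitone.le_of_tendsto tendsto_one_sub_Phi_atTop (x + 1)).trans_lt
    (strictAnti_one_sub_Phi (lt_add_one x))

theorem tendsto_phi_atTop : Tendsto phi atTop (nhds 0) := by
  have h : Tendsto (fun x : ℝ => -x ^ 2 / 2) atTop atBot :=
    (tendsto_neg_atTop_atBot.comp (tendsto_pow_atTop two_ne_zero)).atBot_div_const two_pos
  have h2 := (Real.tendsto_exp_atBot.comp h).const_mul (Real.sqrt (2 * Real.pi))⁻¹
  rwa [mul_zero] at h2

/-- Mills' ratio: the Gaussian tail `1 - Φ(x)` is equivalent to `φ(x)/x` at infinity. -/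
theorem tendsto_mills_ratio :
    Tendsto (fun x => (1 - Phi x) / (phi x / x)) atTop (nhds 1) := by
  have hinv : Tendsto (fun x : ℝ => x⁻¹) atTop (nhds 0) := tendsto_inv_atTop_zero
  refine HasDerivAt.lhopital_zero_atTop (f' := fun x => -phi x)
    (g' := fun x => (-x * phi x * x - phi x * 1) / x ^ 2) ?_ ?_ ?_ tendsto_one_sub_Phi_atTop ?_ ?_
  · exact Eventually.of_forall fun x => (hasDerivAt_Phi x).const_sub 1
  · filter_upwards [eventually_gt_atTop 0] with x hx
    exact (hasDerivAt_phi x).div (hasDerivAt_id x) hx.ne'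
  · filter_upwards [eventually_gt_atTop 0] with x hx
    have := phi_pos x
    have h : -x * phi x * x - phi x * 1 = -(phi x * (x ^ 2 + 1)) := by ring
    rw [h]
    exact div_ne_zero (neg_ne_zero.2 (by positivity)) (by positivity)
  · simpa [div_eq_mul_inv] using tendsto_phi_atTop.mul hinv
  · have h : Tendsto (fun x : ℝ => (1 + x⁻¹ ^ 2)⁻¹) atTop (nhds 1) := by
      simpa using ((hinv.pow 2).const_add 1).inv₀ (by norm_num)
    refine h.congr' ?_
    filter_upwards [eventually_gt_atTop 0] with x hx
    have := (phi_pos x).ne'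
    have h : -x * phi x * x - phi x * 1 = -(phi x * (x ^ 2 + 1)) := by ring
    have h2 : x ^ 2 + 1 ≠ 0 := by positivity
    rw [h]
    field_simp

theorem tendsto_one_sub_Phi_ratio {ι : Type*} {l : Filter ι} {x δ : ι → ℝ} {a : ℝ}
    (hx : Tendsto x l atTop) (hδ : Tendsto δ l (nhds 0))
    (hxδ : Tendsto (fun i => x i * δ i) l (nhds a)) :
    Tendsto (fun i => (1 - Phi (x i + δ i)) / (1 - Phi (x i))) l (nhds (Real.exp (-a))) := by
  have hxd : Tendsto (fun i => x i + δ i) l atTop := hx.atTop_add hδ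
  have hexp : Tendsto (fun i => Real.exp (-(x i * δ i) - δ i ^ 2 / 2)) l
      (nhds (Real.exp (-a))) := by
    simpa [Function.comp_def] using
      (Real.continuous_exp.tendsto _).comp (hxδ.neg.sub ((hδ.pow 2).div_const 2))
  have hfrac : Tendsto (fun i => (1 + δ i / x i)⁻¹) l (nhds 1) := by
    simpa using ((hδ.div_atTop hx).const_add 1).inv₀ (by norm_num)
  have hmain := (((tendsto_mills_ratio.comp hxd).div (tendsto_mills_ratio.comp hx)
    one_ne_zero).mul hexp).mul hfrac
  simp only [div_one, one_mul, mul_one] at hmain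
  refine hmain.congr' ?_
  filter_upwards [hx.eventually_gt_atTop 0, hxd.eventually_gt_atTop 0] with i hi hi'
  have hphi : phi (x i + δ i) = phi (x i) * Real.exp (-(x i * δ i) - δ i ^ 2 / 2) := by
    rw [phi, phi, mul_assoc, ← Real.exp_add]
    ring_nf
  have h1 := (phi_pos (x i)).ne'
  have h2 := (one_sub_Phi_pos (x i)).ne'
  have h3 := (Real.exp_pos (-(x i * δ i) - δ i ^ 2 / 2)).ne'
  have h4 : (1 + δ i / x i)⁻¹ = x i / (x i + δ i) := by field_simp
  simp only [Function.comp_apply, Pi.div_apply]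
  rw [h4, hphi]
  field_simp

theorem tendsto_log_one_sub_Phi_div_sq :
    Tendsto (fun x => Real.log (1 - Phi x) / x ^ 2) atTop (nhds (-(1 / 2))) := by
  have hsq : Tendsto (fun x : ℝ => x ^ 2) atTop atTop := tendsto_pow_atTop two_ne_zero
  have h1 : Tendsto (fun x => Real.log ((1 - Phi x) / (phi x / x))) atTop (nhds 0) := by
    simpa [Function.comp_def] using
      (Real.continuousAt_log one_ne_zero).tendsto.comp tendsto_mills_ratio
  have h2 : Tendsto (fun x : ℝ => Real.log x / x ^ 2) atTop (nhds 0) := by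
    simpa using (isLittleO_log_rpow_atTop (r := 2) two_pos).tendsto_div_nhds_zero
  have h3 := (((h1.div_atTop hsq).sub h2).add
    ((tendsto_const_nhds (x := Real.log (Real.sqrt (2 * Real.pi))⁻¹)).div_atTop hsq)).add_const
      (-(1 / 2) : ℝ)
  simp only [sub_zero, add_zero, zero_add] at h3
  refine h3.congr' ?_
  filter_upwards [eventually_gt_atTop 0] with x hx
  have hp := phi_pos x
  have hlog : Real.log (phi x) = Real.log (Real.sqrt (2 * Real.pi))⁻¹ + -x ^ 2 / 2 := by
    rw [phi, Real.log_mul (by positivity) (Real.exp_pos _).ne', Real.log_exp]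
  rw [Real.log_div (one_sub_Phi_pos x).ne' (by positivity), Real.log_div hp.ne' hx.ne', hlog]
  field_simp
  ring

theorem tendsto_atTop_of_one_sub_Phi {ι : Type*} {l : Filter ι} {x : ι → ℝ}
    (h : Tendsto (fun i => 1 - Phi (x i)) l (nhds 0)) : Tendsto x l atTop := by
  refine tendsto_atTop.2 fun M => ?_
  filter_upwards [h.eventually_lt_const (one_sub_Phi_pos M)] with i hi
  exact (strictAnti_one_sub_Phi.lt_iff_gt.1 hi).le

/-- If `1 - Φ(x_n) = 1/b_n` and `b_n/2^n` has a positive limit, then `x_n ~ √(2 log 2) √n`. -/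
theorem tendsto_quantile_div_sqrt {b x : ℕ → ℝ} {ε : ℝ} (hε : 0 < ε)
    (hb : ∀ n, b n * (1 - Phi (x n)) = 1)
    (hext : Tendsto (fun n => b n / 2 ^ n) atTop (nhds ε)) (hx : Tendsto x atTop atTop) :
    Tendsto (fun n : ℕ => x n / Real.sqrt n) atTop (nhds (Real.sqrt (2 * Real.log 2))) := by
  have hn : Tendsto (fun n : ℕ => (n : ℝ)) atTop atTop := tendsto_natCast_atTop_atTop
  have hlog : Tendsto (fun n => Real.log (b n) / n) atTop (nhds (Real.log 2)) := by
    have h := ((((Real.continuousAt_log hε.ne').tendsto.comp hext).div_atTop hn).add_const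
      (Real.log 2))
    rw [zero_add] at h
    refine h.congr' ?_
    filter_upwards [eventually_gt_atTop 0] with n hn0
    have hn1 : (n : ℝ) ≠ 0 := by positivity
    have hb0 : b n ≠ 0 := left_ne_zero_of_mul_eq_one (hb n)
    rw [Function.comp_apply, Real.log_div hb0 (by positivity), Real.log_pow]
    field_simp
    ring
  have hl2 : Real.log 2 ≠ 0 := (Real.log_pos one_lt_two).ne'
  have hsq : Tendsto (fun n : ℕ => x n ^ 2 / n) atTop (nhds (2 * Real.log 2)) := by
    have h := hlog.div (tendsto_log_one_sub_Phi_div_sq.comp hx).neg (by norm_num)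
    have hval : Real.log 2 / - -(1 / 2) = 2 * Real.log 2 := by ring
    rw [hval] at h
    refine h.congr' ?_
    filter_upwards [hx.eventually_gt_atTop 0, hlog.eventually_ne hl2] with n hxn hne
    have hb0 : Real.log (b n) ≠ 0 := fun h0 => hne (by simp [h0])
    have hT : Real.log (1 - Phi (x n)) = -Real.log (b n) := by
      rw [eq_inv_of_mul_eq_one_right (hb n), Real.log_inv]
    simp only [Pi.div_apply, Function.comp_apply, hT]
    field_simp
  refine hsq.sqrt.congr' ?_
  filter_upwards [hx.eventually_ge_atTop 0] with n hxn
  rw [Real.sqrt_div (sq_nonneg _), Real.sqrt_sq hxn]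

theorem Ginv_le {β u v : ℝ} {n : ℕ} (hv : 0 ≤ v)
    (h : 1 - Phi (Real.log v / (β * Real.sqrt n)) ≤ u) : Ginv β n u ≤ v :=
  csInf_le ⟨0, fun _ hw => hw.1⟩ ⟨hv, h⟩

theorem le_Ginv {β u v w : ℝ} {n : ℕ} (hβ : 0 ≤ β) (hu : u < 1 - Phi 0)
    (h : u < 1 - Phi (Real.log v / (β * Real.sqrt n)))
    (hw : 0 ≤ w) (hwu : 1 - Phi (Real.log w / (β * Real.sqrt n)) ≤ u) : v ≤ Ginv β n u := by
  refine le_csInf ⟨w, hw, hwu⟩ fun z hz => ?_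
  by_contra! hzv
  rcases hz.1.eq_or_lt with rfl | hz0
  · have := hz.2
    simp only [Real.log_zero, zero_div] at this
    linarith
  · have := strictAnti_one_sub_Phi.antitone
      (div_le_div_of_nonneg_right (Real.log_le_log hz0 hzv.le)
        (mul_nonneg hβ (Real.sqrt_nonneg n)))
    have := hz.2
    linarith

/-- Let `r_n` be an extreme space scale (`2^{m_n}/2^n → ε' ∈ (0,1]`) and `β > β_c = √(2 log 2)`,
`α = β_c/β`.  Then for each fixed `u > 0` and any `u_n → u`,
`g_n(u_n) = r_n⁻¹ G_n^{-1}(u_n/b_n) → u^{-1/α}`. -/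
theorem gn_convergence_extreme (β : ℝ) (hβ : Real.sqrt (2 * Real.log 2) < β)
    (ε' : ℝ) (hε'0 : 0 < ε') (hε'1 : ε' ≤ 1)
    (r b : ℕ → ℝ)
    (hr : Tendsto r atTop atTop)
    (hb_def : ∀ n : ℕ, b n * (1 - Phi (Real.log (r n) / (β * Real.sqrt n))) = 1)
    (hext : Tendsto (fun n : ℕ => (2 : ℝ) ^ (Real.log (b n) / Real.log 2) / 2 ^ n)
      atTop (nhds ε'))
    (u : ℝ) (hu : 0 < u) (un : ℕ → ℝ) (hun : Tendsto un atTop (nhds u)) :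
    Tendsto (fun n : ℕ => (r n)⁻¹ * Ginv β n (un n / b n)) atTop
      (nhds (u ^ (-(β / Real.sqrt (2 * Real.log 2))))) := by
  have hlog2 : 0 < Real.log 2 := Real.log_pos one_lt_two
  have hβc : 0 < Real.sqrt (2 * Real.log 2) := Real.sqrt_pos.2 (by positivity)
  set βc := Real.sqrt (2 * Real.log 2)
  have hβ0 : 0 < β := hβc.trans hβ
  have hb0 : ∀ n, 0 < b n := fun n =>
    pos_of_mul_pos_left (by rw [hb_def n]; exact one_pos) (one_sub_Phi_pos _).le
  have hb2 : Tendsto (fun n => b n / 2 ^ n) atTop (nhds ε') := by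
    refine hext.congr fun n => ?_
    rw [Real.rpow_def_of_pos two_pos, mul_div_cancel₀ _ hlog2.ne', Real.exp_log (hb0 n)]
  have hb : Tendsto b atTop atTop := by
    refine (hb2.pos_mul_atTop hε'0 (tendsto_pow_atTop_atTop_of_one_lt one_lt_two)).congr
      fun n => ?_
    exact div_mul_cancel₀ _ (by positivity)
  set x : ℕ → ℝ := fun n => Real.log (r n) / (β * Real.sqrt n)
  have hx : Tendsto x atTop atTop := tendsto_atTop_of_one_sub_Phi <|
    (tendsto_inv_atTop_zero.comp hb).congr fun n => (eq_inv_of_mul_eq_one_right (hb_def n)).symm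
  have hxn := tendsto_quantile_div_sqrt hε'0 hb_def hb2 hx
  have hsqrt : Tendsto (fun n : ℕ => Real.sqrt n) atTop atTop :=
    Real.tendsto_sqrt_atTop.comp tendsto_natCast_atTop_atTop
  have key : ∀ c : ℝ, 0 < c → Tendsto
      (fun n => b n * (1 - Phi (Real.log (r n * c) / (β * Real.sqrt n)))) atTop
      (nhds (c ^ (-(βc / β)))) := by
    intro c hc
    have hδ : Tendsto (fun n : ℕ => Real.log c / (β * Real.sqrt n)) atTop (nhds 0) :=
      tendsto_const_nhds.div_atTop (hsqrt.const_mul_atTop hβ0)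
    have hxδ : Tendsto (fun n : ℕ => x n * (Real.log c / (β * Real.sqrt n))) atTop
        (nhds (βc * (Real.log c / β))) := by
      refine (hxn.mul_const (Real.log c / β)).congr fun n => ?_
      rw [div_mul_div_comm, mul_div_assoc, mul_comm (Real.sqrt n)]
    have h := tendsto_one_sub_Phi_ratio hx hδ hxδ
    have hval : Real.exp (-(βc * (Real.log c / β))) = c ^ (-(βc / β)) := by
      rw [Real.rpow_def_of_pos hc]
      ring_nf
    rw [hval] at h
    refine h.congr' ?_
    filter_upwards [hr.eventually_gt_atTop 0] with n hrn
    rw [Real.log_mul hrn.ne' hc.ne', add_div, eq_inv_of_mul_eq_one_left (hb_def n),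
      div_eq_inv_mul]
  have hmem : ∀ c : ℝ, u ^ (-(β / βc)) < c →
      ∀ᶠ n in atTop, 1 - Phi (Real.log (r n * c) / (β * Real.sqrt n)) ≤ un n / b n := by
    intro c hc
    have hlt : c ^ (-(βc / β)) < u := by
      have := Real.rpow_lt_rpow_of_neg (by positivity) hc
        (neg_neg_of_pos (div_pos hβc hβ0))
      rwa [← Real.rpow_mul hu.le, show -(β / βc) * -(βc / β) = 1 by field_simp,
        Real.rpow_one] at this
    filter_upwards [(key c ((Real.rpow_pos_of_pos hu _).trans hc)).eventually_lt hun hlt] with n hn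
    rw [le_div_iff₀' (hb0 n)]
    exact hn.le
  refine tendsto_order.2 ⟨fun c hc => ?_, fun c hc => ?_⟩
  · obtain ⟨d, hd, hdu⟩ := exists_between (max_lt hc (Real.rpow_pos_of_pos hu _))
    have hd0 : 0 < d := (le_max_right _ _).trans_lt hd
    have hlt : u < d ^ (-(βc / β)) := by
      have := Real.rpow_lt_rpow_of_neg hd0 hdu (neg_neg_of_pos (div_pos hβc hβ0))
      rwa [← Real.rpow_mul hu.le, show -(β / βc) * -(βc / β) = 1 by field_simp,
        Real.rpow_one] at this
    filter_upwards [hun.eventually_lt (key d hd0) hlt, hmem _ (lt_add_one _),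
      (hun.div_atTop hb).eventually_lt_const (one_sub_Phi_pos 0),
      hr.eventually_gt_atTop 0] with n h1 h2 h3 h4
    have h5 := le_Ginv hβ0.le h3 ((div_lt_iff₀' (hb0 n)).2 h1) (by positivity) h2
    refine ((le_max_left _ _).trans_lt hd).trans_le ?_
    rwa [le_inv_mul_iff₀ h4]
  · obtain ⟨d, hdu, hd⟩ := exists_between hc
    have hd0 : 0 < d := (Real.rpow_pos_of_pos hu _).trans hdu
    filter_upwards [hmem d hdu, hr.eventually_gt_atTop 0] with n h1 h2
    refine lt_of_le_of_lt ?_ hd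
    rw [inv_mul_le_iff₀ h2]
    exact Ginv_le (by positivity) h1
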